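/- arXiv:math/0012095 — 4 statements merged into one kernel-verified Lean document; each statement's English description precedes it below -/
import Mathlib

section
/- For every i ∈ Fin k, the sum over all j ≠ i of the partial-conjugation translation vectors V(i,j) weighted by the linking numbers l i j is the zero function on triples: Σ_{j ≠ i} (l i j) · V(i,j) = 0. (Second relation of Theorem 2.7 of the paper.) -/
/-- The partial-conjugation translation vector `V(i,j)` of Lemma 2.5: the change of
Milnor's triple linking number `μ(rst)` (for `r < s < t`) under the partial
conjugation `i^j`.  It vanishes if `{i,j} ⊄ {r,s,t}`, and on a triple `r < s < t`:
`V(r,s) = l r t`, `V(r,t) = −l r s`, `V(s,r) = −l s t`, `V(s,t) = l r s`,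
`V(t,r) = l s t`, `V(t,s) = −l r t`. -/
def partialConjVec {k : ℕ} {A : Type*} [CommRing A] (l : Fin k → Fin k → A)
    (i j r s t : Fin k) : A :=
  (if i = r ∧ j = s then l r t else 0) +
  (if i = r ∧ j = t then -(l r s) else 0) +
  (if i = s ∧ j = r then -(l s t) else 0) +
  (if i = s ∧ j = t then l r s else 0) +
  (if i = t ∧ j = r then l s t else 0) +
  (if i = t ∧ j = s then -(l r t) else 0)

/-- Second relation of Theorem 2.7: for every `i`, the sum over all `j ≠ i` of the
partial-conjugation translation vectors `V(i,j)` weighted by the linking numbers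
`l i j` is the zero function on triples `r < s < t`. -/
theorem sum_smul_partialConjVec_fst_eq_zero {k : ℕ} (hk : 3 ≤ k) {A : Type*} [CommRing A]
    (l : Fin k → Fin k → A) (hl : ∀ i j, l i j = l j i) (i : Fin k)
    (r s t : Fin k) (hrs : r < s) (hst : s < t) :
    ∑ j ∈ Finset.univ \ {i}, l i j * partialConjVec l i j r s t = 0 := by
  have hrs' : r ≠ s := hrs.ne
  have hst' : s ≠ t := hst.ne
  have hrt' : r ≠ t := (hrs.trans hst).ne
  by_cases hr : i = r
  · subst hr
    simp [partialConjVec, mul_add, Finset.sum_add_distrib, hrs', hrt', hrs'.symm, hrt'.symm]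
    ring
  by_cases hs : i = s
  · subst hs
    simp [partialConjVec, mul_add, Finset.sum_add_distrib, hrs', hst', hrs'.symm, hst'.symm]
    rw [hl i r]
    ring
  by_cases ht : i = t
  · subst ht
    simp [partialConjVec, mul_add, Finset.sum_add_distrib, hrt', hst', hrt'.symm, hst'.symm]
    rw [hl i r, hl i s]
    ring
  simp [partialConjVec, hr, hs, ht]
end

section
/- Let k > 3. In the F-vector space of F-valued functions on the set P of ordered pairs (i,j) of distinct elements of Fin k, with standard basis e_{(i,j)}, define for each i ∈ Fin k the vectors E_i = Σ_{j ≠ i} e_{(j,i)} and F_i = Σ_{j ≠ i} x_{ij} · e_{(i,j)}. Then the family of 2k vectors {E_i : i ∈ Fin k} ∪ {F_i : i ∈ Fin k} is linearly independent over F. (Lemma 3.1 of the paper: the 2k relations of Theorem 2.7 are linearly independent for generic values of the linking numbers.) -/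
noncomputable section

/-- The index set of the commuting indeterminates `x_{ij}`: one for each unordered
pair of distinct indices in `Fin k`. -/
abbrev LinkingVar (k : ℕ) := {p : Sym2 (Fin k) // ¬ p.IsDiag}

/-- The polynomial ring `ℚ[x_{ij} : 1 ≤ i < j ≤ k]`. -/
abbrev LinkingPoly (k : ℕ) := MvPolynomial (LinkingVar k) ℚ

/-- The field of fractions `F` of `ℚ[x_{ij} : 1 ≤ i < j ≤ k]`. -/
abbrev LinkingField (k : ℕ) := FractionRing (LinkingPoly k)

/-- The generic linking number `x_{ij} = x_{ji}` attached to the unordered pair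
`{i,j}` of distinct indices (junk value `0` when `i = j`). -/
def genericLinking (k : ℕ) (i j : Fin k) : LinkingPoly k :=
  if h : i = j then 0
  else MvPolynomial.X ⟨s(i, j), by simp [Sym2.mk_isDiag_iff, h]⟩

/-- The generic linking number, viewed in the field of fractions `F`. -/
def genericLinkingF (k : ℕ) (i j : Fin k) : LinkingField k :=
  algebraMap (LinkingPoly k) (LinkingField k) (genericLinking k i j)

/-- The set `P` of ordered pairs of distinct elements of `Fin k`. -/
abbrev DistinctPairs (k : ℕ) := {p : Fin k × Fin k // p.1 ≠ p.2}

/-- The standard basis vector `e_{(i,j)}` of the `F`-vector space of `F`-valued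
functions on `P`. -/
def stdBasisVec (k : ℕ) (p : DistinctPairs k) : DistinctPairs k → LinkingField k :=
  fun q => if q = p then 1 else 0

/-- `E_i = Σ_{j ≠ i} e_{(j,i)}`. -/
def Evec (k : ℕ) (i : Fin k) : DistinctPairs k → LinkingField k :=
  ∑ p ∈ Finset.univ.filter (fun p : DistinctPairs k => p.val.2 = i), stdBasisVec k p

/-- `F_i = Σ_{j ≠ i} x_{ij} · e_{(i,j)}`. -/
def Fvec (k : ℕ) (i : Fin k) : DistinctPairs k → LinkingField k :=
  ∑ p ∈ Finset.univ.filter (fun p : DistinctPairs k => p.val.1 = i),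
    genericLinkingF k p.val.1 p.val.2 • stdBasisVec k p

theorem genericLinking_of_ne {k : ℕ} {i j : Fin k} (h : i ≠ j) :
    genericLinking k i j = MvPolynomial.X ⟨s(i, j), by simpa using h⟩ := by
  simp [genericLinking, h]

theorem genericLinkingF_ne_zero {k : ℕ} {i j : Fin k} (h : i ≠ j) :
    genericLinkingF k i j ≠ 0 := by
  rw [genericLinkingF, genericLinking_of_ne h, ne_eq, FaithfulSMul.algebraMap_eq_zero_iff]
  exact MvPolynomial.X_ne_zero _

/-- The `2 × 2` minor of the generic linking matrix with rows `i, l` and columns `j, m`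
does not vanish. -/
theorem genericLinkingF_mul_ne {k : ℕ} {i l j m : Fin k} (hil : i ≠ l) (hij : i ≠ j)
    (him : i ≠ m) (hlj : l ≠ j) (hlm : l ≠ m) (hjm : j ≠ m) :
    genericLinkingF k i j * genericLinkingF k l m ≠
      genericLinkingF k l j * genericLinkingF k i m := by
  simp only [genericLinkingF, ← map_mul]
  rw [(FaithfulSMul.algebraMap_injective (LinkingPoly k) (LinkingField k)).ne_iff,
    genericLinking_of_ne hij, genericLinking_of_ne hlm, genericLinking_of_ne hlj,
    genericLinking_of_ne him]
  intro h
  have := congrArg (MvPolynomial.eval fun v : LinkingVar k => if v.1 = s(l, j) then 0 else 1) h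
  simp [hil, hij, hlj, hjm.symm] at this

theorem Evec_apply (k : ℕ) (i : Fin k) (q : DistinctPairs k) :
    Evec k i q = if q.val.2 = i then 1 else 0 := by
  simp [Evec, stdBasisVec, Finset.sum_apply]

theorem Fvec_apply (k : ℕ) (i : Fin k) (q : DistinctPairs k) :
    Fvec k i q = if q.val.1 = i then genericLinkingF k q.val.1 q.val.2 else 0 := by
  simp [Fvec, stdBasisVec, Finset.sum_apply]

theorem exists_distinct_triple_ne {k : ℕ} (hk : 3 < k) (i : Fin k) :
    ∃ l j m : Fin k, i ≠ l ∧ i ≠ j ∧ i ≠ m ∧ l ≠ j ∧ l ≠ m ∧ j ≠ m := by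
  have h : 2 < (Finset.univ.erase i).card := by
    rw [Finset.card_erase_of_mem (Finset.mem_univ i), Finset.card_fin]
    omega
  obtain ⟨l, j, m, hl, hj, hm, hlj, hlm, hjm⟩ := Finset.two_lt_card_iff.mp h
  exact ⟨l, j, m, (Finset.ne_of_mem_erase hl).symm, (Finset.ne_of_mem_erase hj).symm,
    (Finset.ne_of_mem_erase hm).symm, hlj, hlm, hjm⟩

/-- Lemma 3.1: for `k > 3`, the `2k` vectors `E_i`, `F_i` (`i ∈ Fin k`) are linearly
independent over the field `F` of generic linking numbers. -/
theorem evec_fvec_linearIndependent (k : ℕ) (hk : 3 < k) :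
    LinearIndependent (LinkingField k)
      (Sum.elim (Evec k) (Fvec k) : Fin k ⊕ Fin k → (DistinctPairs k → LinkingField k)) := by
  rw [Fintype.linearIndependent_iff]
  intro g hg
  have coord : ∀ i j : Fin k, i ≠ j →
      g (.inl j) + g (.inr i) * genericLinkingF k i j = 0 := by
    intro i j hij
    have := congrFun hg ⟨(i, j), hij⟩
    simpa [Fintype.sum_sum_type, Finset.sum_apply, Evec_apply, Fvec_apply] using this
  have hF : ∀ i, g (.inr i) = 0 := by
    intro i
    obtain ⟨l, j, m, hil, hij, him, hlj, hlm, hjm⟩ := exists_distinct_triple_ne hk i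
    have minor : g (.inr i) * g (.inr l) *
        (genericLinkingF k i j * genericLinkingF k l m -
          genericLinkingF k l j * genericLinkingF k i m) = 0 := by
      linear_combination g (.inr l) * genericLinkingF k l m * coord i j hij
        - g (.inl j) * coord l m hlm + g (.inl j) * coord i m him
        - g (.inr i) * genericLinkingF k i m * coord l j hlj
    rcases mul_eq_zero.mp minor with h | h
    · rcases mul_eq_zero.mp h with h | h
      · exact h
      · have hj : g (.inl j) = 0 := by simpa [h] using coord l j hlj
        simpa [hj, genericLinkingF_ne_zero hij] using coord i j hij
    · exact absurd (sub_eq_zero.mp h) (genericLinkingF_mul_ne hil hij him hlj hlm hjm)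
  rintro (j | i)
  · obtain ⟨i, -, -, hji, -⟩ := exists_distinct_triple_ne hk j
    simpa [hF i] using coord i j hji.symm
  · exact hF i

end
end

section
/- Let k > 3. The dimension of the F-linear span of the k(k−1) partial-conjugation translation vectors {V(i,j) : i, j ∈ Fin k, i ≠ j}, inside the F-vector space of F-valued functions on the set of triples r < s < t of elements of Fin k, is at most k² − 3k = k(k−1) − 2k. (This is the dimension bound dim(𝒫) ≤ k² − 3k established in Section 3 of the paper.) -/
noncomputable section

/-- The set of triples `r < s < t` of elements of `Fin k`. -/
abbrev OrderedTriple (k : ℕ) :=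
  {T : Fin k × Fin k × Fin k // T.1 < T.2.1 ∧ T.2.1 < T.2.2}

/-- The partial-conjugation translation vector `V(i,j)` of Lemma 2.5, with values the
generic linking numbers: the change of Milnor's triple linking number `μ(rst)` under
the partial conjugation `i^j`.  It vanishes if `{i,j} ⊄ {r,s,t}`, and on a triple
`r < s < t`: `V(r,s) = x_{rt}`, `V(r,t) = −x_{rs}`, `V(s,r) = −x_{st}`,
`V(s,t) = x_{rs}`, `V(t,r) = x_{st}`, `V(t,s) = −x_{rt}`. -/
def partialConjVecPoly (k : ℕ) (i j : Fin k) (T : OrderedTriple k) : LinkingPoly k :=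
  let r := T.val.1; let s := T.val.2.1; let t := T.val.2.2
  (if i = r ∧ j = s then genericLinking k r t else 0) +
  (if i = r ∧ j = t then -(genericLinking k r s) else 0) +
  (if i = s ∧ j = r then -(genericLinking k s t) else 0) +
  (if i = s ∧ j = t then genericLinking k r s else 0) +
  (if i = t ∧ j = r then genericLinking k s t else 0) +
  (if i = t ∧ j = s then -(genericLinking k r t) else 0)

/-- The vector `V(i,j)`, viewed in the `F`-vector space of `F`-valued functions on the
set of triples `r < s < t`. -/
def partialConjVecF (k : ℕ) (i j : Fin k) : OrderedTriple k → LinkingField k :=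
  fun T => algebraMap (LinkingPoly k) (LinkingField k) (partialConjVecPoly k i j T)

theorem genericLinking_comm (k : ℕ) (i j : Fin k) :
    genericLinking k i j = genericLinking k j i := by
  unfold genericLinking
  by_cases h : i = j
  · simp [h]
  · simp [h, Ne.symm h, Sym2.eq_swap]

theorem genericLinking_mul_ne {k : ℕ} {i i' j j' : Fin k} (hii' : i ≠ i') (hij : i ≠ j)
    (hij' : i ≠ j') (hi'j : i' ≠ j) (hi'j' : i' ≠ j') (hjj' : j ≠ j') :
    genericLinking k i j * genericLinking k i' j' ≠
      genericLinking k i' j * genericLinking k i j' := by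
  intro h
  have h' := congrArg (MvPolynomial.eval fun v : LinkingVar k =>
    if v.val = s(i, j) ∨ v.val = s(i', j') then (1 : ℚ) else 0) h
  simp [genericLinking, hii', hii'.symm, hij, hij', hi'j, hi'j', hjj', hjj'.symm] at h'

/-- The generic linking number `x_{ij}` as an element of the field of fractions. -/
def linkingF (k : ℕ) (i j : Fin k) : LinkingField k :=
  algebraMap (LinkingPoly k) (LinkingField k) (genericLinking k i j)

theorem linkingF_comm (k : ℕ) (i j : Fin k) : linkingF k i j = linkingF k j i := by
  rw [linkingF, genericLinking_comm, linkingF]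

theorem linkingF_mul_ne {k : ℕ} {i i' j j' : Fin k} (hii' : i ≠ i') (hij : i ≠ j)
    (hij' : i ≠ j') (hi'j : i' ≠ j) (hi'j' : i' ≠ j') (hjj' : j ≠ j') :
    linkingF k i j * linkingF k i' j' ≠ linkingF k i' j * linkingF k i j' := by
  simp only [linkingF, ← map_mul]
  exact (IsFractionRing.injective (LinkingPoly k) (LinkingField k)).ne
    (genericLinking_mul_ne hii' hij hij' hi'j hi'j' hjj')

theorem sum_smul_partialConjVecF_apply (k : ℕ) (f : Fin k × Fin k → LinkingField k)
    (T : OrderedTriple k) :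
    (∑ p, f p • partialConjVecF k p.1 p.2) T =
      f (T.val.1, T.val.2.1) * linkingF k T.val.1 T.val.2.2
      - f (T.val.1, T.val.2.2) * linkingF k T.val.1 T.val.2.1
      - f (T.val.2.1, T.val.1) * linkingF k T.val.2.1 T.val.2.2
      + f (T.val.2.1, T.val.2.2) * linkingF k T.val.1 T.val.2.1
      + f (T.val.2.2, T.val.1) * linkingF k T.val.2.1 T.val.2.2
      - f (T.val.2.2, T.val.2.1) * linkingF k T.val.1 T.val.2.2 := by
  have key (u v : Fin k) (c : LinkingField k) :
      ∑ p : Fin k × Fin k, f p * (if p.1 = u ∧ p.2 = v then c else 0) = f (u, v) * c := by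
    rw [Finset.sum_eq_single (u, v)] <;> simp +contextual [Prod.ext_iff]
  simp only [Finset.sum_apply, Pi.smul_apply, smul_eq_mul, partialConjVecF, partialConjVecPoly,
    map_add, apply_ite (algebraMap (LinkingPoly k) (LinkingField k)), map_neg, map_zero,
    mul_add, Finset.sum_add_distrib, key]
  simp only [linkingF]
  ring

/-- The coefficient families `a i * x_{ij} + b j` on ordered pairs, with an arbitrary
diagonal correction `c`; they parametrize relations among the vectors `V(i,j)`. -/
def relationMap (k : ℕ) :
    ((Fin k → LinkingField k) × (Fin k → LinkingField k) × (Fin k → LinkingField k))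
      →ₗ[LinkingField k]
      (Fin k × Fin k → LinkingField k) where
  toFun q p := q.1 p.1 * linkingF k p.1 p.2 + q.2.1 p.2 + if p.1 = p.2 then q.2.2 p.1 else 0
  map_add' q q' := by
    funext p
    simp only [Prod.fst_add, Prod.snd_add, Pi.add_apply]
    split_ifs <;> ring
  map_smul' c q := by
    funext p
    simp only [Prod.smul_fst, Prod.smul_snd, Pi.smul_apply, smul_eq_mul, RingHom.id_apply]
    split_ifs <;> ring

theorem relationMap_apply (k : ℕ)
    (q : (Fin k → LinkingField k) × (Fin k → LinkingField k) × (Fin k → LinkingField k))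
    (i j : Fin k) :
    relationMap k q (i, j) =
      q.1 i * linkingF k i j + q.2.1 j + if i = j then q.2.2 i else 0 := rfl

theorem relationMap_injective {k : ℕ} (hk : 3 < k) : Function.Injective (relationMap k) := by
  rw [injective_iff_map_eq_zero]
  rintro ⟨a, b, c⟩ h
  have off (i j : Fin k) (hij : i ≠ j) : a i * linkingF k i j + b j = 0 := by
    simpa [relationMap_apply, hij] using congrFun h (i, j)
  have diag (i : Fin k) : a i * linkingF k i i + b i + c i = 0 := by
    simpa [relationMap_apply] using congrFun h (i, i)
  have ha (i : Fin k) : a i = 0 := by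
    have hcard : 2 < (Finset.univ.erase i).card := by
      rw [Finset.card_erase_of_mem (Finset.mem_univ i), Finset.card_univ, Fintype.card_fin]
      omega
    obtain ⟨i', hi', j, hj, j', hj', hi'j, hi'j', hjj'⟩ := Finset.two_lt_card.1 hcard
    have hi' := (Finset.ne_of_mem_erase hi').symm
    have hj := (Finset.ne_of_mem_erase hj).symm
    have hj' := (Finset.ne_of_mem_erase hj').symm
    have hdet := sub_ne_zero.2 (linkingF_mul_ne hi' hj hj' hi'j hi'j' hjj')
    refine (mul_eq_zero.1 ?_).resolve_right hdet
    linear_combination linkingF k i' j' * (off i j hj - off i' j hi'j)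
      - linkingF k i' j * (off i j' hj' - off i' j' hi'j')
  have hb (j : Fin k) : b j = 0 := by
    have : Nontrivial (Fin k) := Fin.nontrivial_iff_two_le.2 (by omega)
    obtain ⟨i, hij⟩ := exists_ne j
    simpa [ha] using off i j hij
  have hc (i : Fin k) : c i = 0 := by simpa [ha, hb] using diag i
  exact Prod.ext (funext ha) (Prod.ext (funext hb) (funext hc))

theorem sum_relationMap_smul_partialConjVecF (k : ℕ)
    (q : (Fin k → LinkingField k) × (Fin k → LinkingField k) × (Fin k → LinkingField k)) :
    ∑ p, relationMap k q p • partialConjVecF k p.1 p.2 = 0 := by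
  funext T
  rw [sum_smul_partialConjVecF_apply]
  obtain ⟨⟨r, s, t⟩, hrs, hst⟩ := T
  have hrs' : r ≠ s := ne_of_lt hrs
  have hst' : s ≠ t := ne_of_lt hst
  have hrt' : r ≠ t := ne_of_lt (lt_trans hrs hst)
  simp only [relationMap_apply, hrs', hst', hrt', hrs'.symm, hst'.symm, hrt'.symm, if_false,
    linkingF_comm k s r, linkingF_comm k t r, linkingF_comm k t s, Pi.zero_apply]
  ring

/-- The dimension bound of Section 3: for `k > 3`, the `F`-linear span of the `k(k−1)`
partial-conjugation translation vectors `V(i,j)` (`i ≠ j`) has dimension at most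
`k² − 3k`. -/
theorem span_partialConjVec_finrank_le (k : ℕ) (hk : 3 < k) :
    Module.finrank (LinkingField k)
      (Submodule.span (LinkingField k)
        {f : OrderedTriple k → LinkingField k |
          ∃ i j : Fin k, i ≠ j ∧ f = partialConjVecF k i j})
      ≤ k ^ 2 - 3 * k := by
  set L := Fintype.linearCombination (LinkingField k)
    fun p : Fin k × Fin k => partialConjVecF k p.1 p.2 with hL
  have hspan : Submodule.span (LinkingField k)
      {f : OrderedTriple k → LinkingField k |
        ∃ i j : Fin k, i ≠ j ∧ f = partialConjVecF k i j} ≤ LinearMap.range L := by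
    rw [hL, Fintype.range_linearCombination]
    apply Submodule.span_mono
    rintro _ ⟨i, j, -, rfl⟩
    exact ⟨(i, j), rfl⟩
  have hker : LinearMap.range (relationMap k) ≤ LinearMap.ker L := by
    rintro _ ⟨q, rfl⟩
    rw [LinearMap.mem_ker, hL, Fintype.linearCombination_apply]
    exact sum_relationMap_smul_partialConjVecF k q
  have hle := Submodule.finrank_mono hspan
  have hkle := Submodule.finrank_mono hker
  have hrel := LinearMap.finrank_range_of_inj (relationMap_injective hk)
  have hnull := L.finrank_range_add_finrank_ker
  simp only [Module.finrank_prod, Module.finrank_fintype_fun_eq_card, Fintype.card_fin,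
    Fintype.card_prod] at hrel hnull
  rw [pow_two]
  omega

end
end

section
/- Let k ≥ 6. There exists a nonzero vector Ω, assigning to each triple T = (r,s,t) with r < s < t of elements of Fin k a polynomial Ω(T) in the ring ℚ[x_{ij} : 1 ≤ i < j ≤ k], not all zero, such that for every ordered pair (i,j) of distinct indices the inner product vanishes: Σ_T V(i,j)(T) · Ω(T) = 0, where the sum is over all triples T. (This is the key construction in Theorem 3.3 of the paper, producing a nontrivial finite type link-homotopy invariant polynomial μ·Ω for links with k ≥ 6 components.) -/
noncomputable section

section JacobianCriterion

open MvPolynomial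

variable {σ A : Type*} [Fintype σ] [CommRing A] [Algebra ℚ A]

/-- Chain rule for a derivation applied to a polynomial expression. -/
theorem Derivation.map_mvPolynomial_aeval (D : Derivation ℚ A A) (y : σ → A)
    (f : MvPolynomial σ ℚ) :
    D (aeval y f) = ∑ e, aeval y (pderiv e f) * D (y e) := by
  classical
  induction f using MvPolynomial.induction_on with
  | C a => simp
  | add p q hp hq => simp [hp, hq, add_mul, Finset.sum_add_distrib]
  | mul_X p e hp =>
    simp only [map_mul, aeval_X, Derivation.leibniz, hp, smul_eq_mul, pderiv_X, map_add, add_mul,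
      Finset.sum_add_distrib, Finset.mul_sum]
    congr 1
    · rw [Finset.sum_eq_single e]
      · simp
      · intro b _ hb
        simp [hb.symm]
      · simp
    · exact Finset.sum_congr rfl fun _ _ => by ring

/-- The Jacobian criterion for algebraic independence in characteristic zero: if the matrix of
derivatives of the family `y` along the derivations `D v` has trivial left kernel, then `y`
satisfies no nontrivial polynomial relation. -/
theorem MvPolynomial.aeval_injective_of_jacobian [Nontrivial A] {ι : Type*}
    (D : ι → Derivation ℚ A A) (y : σ → A)
    (hD : ∀ g : σ → A, (∀ v, ∑ e, g e * D v (y e) = 0) → g = 0) :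
    Function.Injective (aeval y : MvPolynomial σ ℚ →ₐ[ℚ] A) := by
  classical
  have key : ∀ (n : ℕ) (f : MvPolynomial σ ℚ), (∀ m : σ →₀ ℕ, n ≤ m.degree → coeff m f = 0) →
      aeval y f = 0 → f = 0 := by
    intro n
    induction n with
    | zero =>
      intro f hf _
      ext m
      simpa using hf m (Nat.zero_le _)
    | succ n ih =>
      intro f hf h0
      have hg : (fun e => aeval y (pderiv e f)) = 0 := by
        refine hD _ fun v => ?_
        rw [← Derivation.map_mvPolynomial_aeval, h0, map_zero]
      have hp : ∀ e, pderiv e f = 0 := fun e => by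
        refine ih _ (fun m hm => ?_) (congrFun hg e)
        rw [coeff_pderiv, hf _ (by simpa using hm), zero_mul]
      have hC : f = C (coeff 0 f) := by
        ext m
        rw [coeff_C]
        split_ifs with hm
        · rw [hm]
        · obtain ⟨e, he⟩ : ∃ e, m e ≠ 0 := by
            by_contra! h
            exact hm (Finsupp.ext h).symm
          have hsub : m - Finsupp.single e 1 + Finsupp.single e 1 = m :=
            tsub_add_cancel_of_le (by simpa using Nat.one_le_iff_ne_zero.mpr he)
          have hc := coeff_pderiv f (i := e) (m - Finsupp.single e 1)
          rw [hp e, hsub, coeff_zero] at hc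
          exact (mul_eq_zero.mp hc.symm).resolve_right (by positivity)
      rw [hC] at h0 ⊢
      rw [aeval_C, map_eq_zero_iff _ (algebraMap ℚ A).injective] at h0
      rw [h0, map_zero]
  rw [injective_iff_map_eq_zero]
  refine fun f hf => key (f.totalDegree + 1) f (fun m hm => ?_) hf
  exact coeff_eq_zero_of_totalDegree_lt (Nat.lt_of_succ_le hm)

/-- A polynomial matrix acquiring a kernel vector after an injective base change to a domain
already has a kernel vector over the polynomial ring. -/
theorem MvPolynomial.exists_mulVec_eq_zero_of_injective {τ m n : Type*} [Fintype m] [Fintype n]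
    {B : Type*} [CommRing B] [IsDomain B] (φ : MvPolynomial τ ℚ →+* B)
    (hφ : Function.Injective φ) (M : Matrix m n (MvPolynomial τ ℚ)) (v : n → B) (hv : v ≠ 0)
    (hM : (M.map φ).mulVec v = 0) : ∃ w : n → MvPolynomial τ ℚ, w ≠ 0 ∧ M.mulVec w = 0 := by
  classical
  have hdet : (M.transpose * M).det = 0 := by
    apply hφ
    rw [map_zero, RingHom.map_det, ← Matrix.exists_mulVec_eq_zero_iff]
    refine ⟨v, hv, ?_⟩
    rw [RingHom.mapMatrix_apply, Matrix.map_mul, ← Matrix.mulVec_mulVec, hM, Matrix.mulVec_zero]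
  obtain ⟨w, hw, hw0⟩ := Matrix.exists_mulVec_eq_zero_iff.mpr hdet
  refine ⟨w, hw, ?_⟩
  have hsq : ∑ a, M.mulVec w a * M.mulVec w a = 0 := by
    change M.mulVec w ⬝ᵥ M.mulVec w = 0
    nth_rewrite 1 [← Matrix.transpose_transpose M]
    rw [Matrix.mulVec_transpose, ← Matrix.dotProduct_mulVec, Matrix.mulVec_mulVec, hw0,
      dotProduct_zero]
  funext a
  refine MvPolynomial.funext fun q => ?_
  have hq := congrArg (eval q) hsq
  rw [map_sum, map_zero, Finset.sum_eq_zero_iff_of_nonneg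
    (fun _ _ => by rw [map_mul]; exact mul_self_nonneg _)] at hq
  simpa using hq a (Finset.mem_univ a)

end JacobianCriterion

section TranslationVector

variable {k : ℕ} {A : Type*} [CommRing A]

/-- The partial-conjugation translation vector with linking numbers `y` in a ring `A`. -/
def conjVec (y : Fin k → Fin k → A) (i j : Fin k) (T : OrderedTriple k) : A :=
  let r := T.val.1; let s := T.val.2.1; let t := T.val.2.2
  (if i = r ∧ j = s then y r t else 0) +
  (if i = r ∧ j = t then -(y r s) else 0) +
  (if i = s ∧ j = r then -(y s t) else 0) +
  (if i = s ∧ j = t then y r s else 0) +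
  (if i = t ∧ j = r then y s t else 0) +
  (if i = t ∧ j = s then -(y r t) else 0)

theorem map_conjVec {B : Type*} [CommRing B] (φ : A →+* B) (y : Fin k → Fin k → A)
    (i j : Fin k) (T : OrderedTriple k) :
    φ (conjVec y i j T) = conjVec (fun a b => φ (y a b)) i j T := by
  simp [conjVec, apply_ite φ]

theorem sum_orderedTriple (f : Fin k → Fin k → Fin k → A) :
    ∑ T : OrderedTriple k, f T.val.1 T.val.2.1 T.val.2.2 =
      ∑ r, ∑ s, ∑ t, if r < s ∧ s < t then f r s t else 0 := by
  rw [← Finset.sum_subtype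
    (Finset.univ.filter fun T : Fin k × Fin k × Fin k => T.1 < T.2.1 ∧ T.2.1 < T.2.2)
    (by simp) (fun T => f T.1 T.2.1 T.2.2), Finset.sum_filter]
  simp only [Fintype.sum_prod_type]

/-- Pairing a translation vector with an alternating function of triples is a contraction. -/
theorem sum_conjVec_mul (y : Fin k → Fin k → A) (hy : ∀ i j, y i j = y j i)
    (ω : Fin k → Fin k → Fin k → A) (h12 : ∀ i j t, ω i j t = -ω j i t)
    (h23 : ∀ i j t, ω i j t = -ω i t j) (h11 : ∀ i t, ω i i t = 0) (i j : Fin k) :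
    ∑ T : OrderedTriple k, conjVec y i j T * ω T.val.1 T.val.2.1 T.val.2.2 =
      ∑ t, y i t * ω i j t := by
  have h_rs (f : Fin k → Fin k → Fin k → A) (a b : Fin k) :
      ∑ r, ∑ s, ∑ t, (if a = r ∧ b = s then f r s t else 0) = ∑ t, f a b t := by
    simp [ite_and]
  have h_rt (f : Fin k → Fin k → Fin k → A) (a b : Fin k) :
      ∑ r, ∑ s, ∑ t, (if a = r ∧ b = t then f r s t else 0) = ∑ t, f a t b := by
    simp [ite_and]
  have h_st (f : Fin k → Fin k → Fin k → A) (a b : Fin k) :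
      ∑ r, ∑ s, ∑ t, (if a = s ∧ b = t then f r s t else 0) = ∑ t, f t a b := by
    simp [ite_and]
  let W : Fin k → Fin k → Fin k → A := fun r s t => if r < s ∧ s < t then ω r s t else 0
  have hsplit : ∑ T : OrderedTriple k, conjVec y i j T * ω T.val.1 T.val.2.1 T.val.2.2 =
      ∑ r, ∑ s, ∑ t, ((if i = r ∧ j = s then y r t * W r s t else 0) +
        (if i = r ∧ j = t then -(y r s) * W r s t else 0) +
        (if j = r ∧ i = s then -(y s t) * W r s t else 0) +
        (if i = s ∧ j = t then y r s * W r s t else 0) +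
        (if j = r ∧ i = t then y s t * W r s t else 0) +
        (if j = s ∧ i = t then -(y r t) * W r s t else 0)) := by
    refine (sum_orderedTriple fun r s t => ((if i = r ∧ j = s then y r t else 0) +
      (if i = r ∧ j = t then -(y r s) else 0) + (if i = s ∧ j = r then -(y s t) else 0) +
      (if i = s ∧ j = t then y r s else 0) + (if i = t ∧ j = r then y s t else 0) +
      (if i = t ∧ j = s then -(y r t) else 0)) * ω r s t).trans ?_
    refine Finset.sum_congr rfl fun r _ => Finset.sum_congr rfl fun s _ =>
      Finset.sum_congr rfl fun t _ => ?_
    by_cases h : r < s ∧ s < t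
    · simp only [W, if_pos h, add_mul, ite_mul, zero_mul, and_comm]
    · simp only [W, if_neg h, mul_zero, ite_self, add_zero]
  simp only [hsplit, Finset.sum_add_distrib, h_rs, h_rt, h_st]
  simp only [← Finset.sum_add_distrib]
  refine Finset.sum_congr rfl fun t _ => ?_
  have e1 : ω j i t = -ω i j t := h12 j i t
  have e2 : ω i t j = -ω i j t := h23 i t j
  have e3 : ω t i j = ω i j t := by rw [h12, e2, neg_neg]
  have e4 : ω j t i = ω i j t := by rw [h23, e1, neg_neg]
  have e5 : ω t j i = -ω i j t := by rw [h12, e4]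
  have z1 : i = j → ω i j t = 0 := fun h => by rw [h, h11]
  have z2 : i = t → ω i j t = 0 := fun h => by rw [h, h23, h11, neg_zero]
  have z3 : j = t → ω i j t = 0 := fun h => by rw [h, h12, h23, h11, neg_zero, neg_zero]
  simp only [W, e1, e2, e3, e4, e5, hy t i]
  rcases lt_trichotomy i j with h | h | h <;> rcases lt_trichotomy i t with h' | h' | h' <;>
    rcases lt_trichotomy j t with h'' | h'' | h'' <;>
    first
    | simp [z1 h]
    | simp [z2 h']
    | simp [z3 h'']
    | (exfalso; order)
    | simp [h, h', h'', h.not_gt, h'.not_gt, h''.not_gt]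


/-- A kernel vector over an injective base change to a domain yields a polynomial vector orthogonal
to all the generic translation vectors. -/
theorem exists_perp_of_base_change {B : Type*} [CommRing B] [IsDomain B]
    (φ : LinkingPoly k →+* B) (hφ : Function.Injective φ) (v : OrderedTriple k → B) (hv : v ≠ 0)
    (h : ∀ i j, ∑ T, conjVec (fun a b => φ (genericLinking k a b)) i j T * v T = 0) :
    ∃ Ω : OrderedTriple k → LinkingPoly k, Ω ≠ 0 ∧
      ∀ i j, ∑ T, conjVec (genericLinking k) i j T * Ω T = 0 := by
  obtain ⟨w, hw, hw0⟩ := MvPolynomial.exists_mulVec_eq_zero_of_injective φ hφ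
    (Matrix.of fun (p : Fin k × Fin k) T => conjVec (genericLinking k) p.1 p.2 T) v hv (by
      funext p
      simpa [Matrix.mulVec, dotProduct, map_conjVec] using h p.1 p.2)
  exact ⟨w, hw, fun i j => congrFun hw0 (i, j)⟩

/-- Solutions of the orthogonality equations extend by zero to more components. -/
theorem exists_perp_of_le {n : ℕ} (hn : n ≤ k)
    (h : ∃ Ω : OrderedTriple n → LinkingPoly n, Ω ≠ 0 ∧
      ∀ i j, ∑ T, conjVec (genericLinking n) i j T * Ω T = 0) :
    ∃ Ω : OrderedTriple k → LinkingPoly k, Ω ≠ 0 ∧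
      ∀ i j, ∑ T, conjVec (genericLinking k) i j T * Ω T = 0 := by
  obtain ⟨Ω, hΩ, h0⟩ := h
  let c : Fin n → Fin k := Fin.castLE hn
  have hc : Function.Injective c := Fin.castLE_injective hn
  let ι : OrderedTriple n → OrderedTriple k := fun T =>
    ⟨(c T.val.1, c T.val.2.1, c T.val.2.2), T.prop⟩
  have hι : Function.Injective ι := fun S T hST => by
    simp only [ι, Subtype.mk.injEq, Prod.mk.injEq, hc.eq_iff] at hST
    exact Subtype.ext (Prod.ext hST.1 (Prod.ext hST.2.1 hST.2.2))
  let e : LinkingVar n → LinkingVar k := fun p =>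
    ⟨p.val.map c, by rw [Sym2.isDiag_map hc]; exact p.prop⟩
  have he : Function.Injective e := fun p q hpq =>
    Subtype.ext (Sym2.map.injective hc (congrArg Subtype.val hpq))
  let ρ : LinkingPoly n →+* LinkingPoly k := (MvPolynomial.rename e).toRingHom
  have hρ : Function.Injective ρ := MvPolynomial.rename_injective e he
  have hlink : ∀ a b, ρ (genericLinking n a b) = genericLinking k (c a) (c b) := fun a b => by
    by_cases hab : a = b
    · simp [genericLinking, hab]
    · simp [genericLinking, hab, hc.eq_iff, ρ, e]
  refine ⟨Function.extend ι (fun T => ρ (Ω T)) 0, fun hz => hΩ ?_, fun i j => ?_⟩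
  · funext T
    have hT := congrFun hz (ι T)
    rw [hι.extend_apply] at hT
    exact hρ (by simpa using hT)
  · rw [← Fintype.sum_of_injective ι hι
      (fun T => conjVec (genericLinking k) i j (ι T) * ρ (Ω T)) _
      (fun T hT => by rw [Function.extend_apply' _ _ _ (by simpa using hT)]; simp)
      (fun T => by rw [hι.extend_apply])]
    by_cases hij : i ∈ Set.range c ∧ j ∈ Set.range c
    · obtain ⟨⟨a, rfl⟩, b, rfl⟩ := hij
      have hab := congrArg ρ (h0 a b)
      rw [map_sum, map_zero] at hab
      rw [← hab]
      refine Finset.sum_congr rfl fun T _ => ?_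
      rw [map_mul, map_conjVec]
      simp [conjVec, ι, hlink, hc.eq_iff]
    · refine Finset.sum_eq_zero fun T _ => ?_
      have hne : ∀ a b, ¬ (i = c a ∧ j = c b) := fun a b h =>
        hij ⟨⟨a, h.1.symm⟩, ⟨b, h.2.symm⟩⟩
      simp [conjVec, ι, hne]

end TranslationVector

section GenericConfiguration

open MvPolynomial Matrix

/-- Six vectors in three-space in sufficiently general position (the rows of `A` and of `B`) admit
no nonzero equilibrium stress (the symmetric matrix with blocks `U`, `V`, `Vᵀ`, `W`). -/
theorem equilibriumStress_eq_zero {R : Type*} [CommRing R] [IsDomain R] [CharZero R]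
    (A B U V W : Matrix (Fin 3) (Fin 3) R) (hU : U.IsSymm) (hU0 : ∀ p, U p p = 0)
    (hW0 : ∀ p, W p p = 0) (h₁ : U * A + V * B = 0) (h₂ : Vᵀ * A + W * B = 0)
    (hB : B.det ≠ 0)
    (hA : (Matrix.of fun p : Fin 3 =>
      ![(A * B.adjugate) 1 p * (A * B.adjugate) 2 p, (A * B.adjugate) 0 p * (A * B.adjugate) 2 p,
        (A * B.adjugate) 0 p * (A * B.adjugate) 1 p]).det ≠ 0) :
    U = 0 ∧ V = 0 ∧ W = 0 := by
  set N := A * B.adjugate with hN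
  have hUN : U * N = -(B.det • V) := by
    have := congrArg (· * B.adjugate) h₁
    simp only [add_mul, Matrix.mul_assoc, Matrix.mul_adjugate, zero_mul, ← hN] at this
    rw [eq_neg_of_add_eq_zero_left this, Matrix.mul_smul, Matrix.mul_one]
  have hVN : Vᵀ * N = -(B.det • W) := by
    have := congrArg (· * B.adjugate) h₂
    simp only [add_mul, Matrix.mul_assoc, Matrix.mul_adjugate, zero_mul, ← hN] at this
    rw [eq_neg_of_add_eq_zero_left this, Matrix.mul_smul, Matrix.mul_one]
  have hNUN : Nᵀ * (U * N) = B.det • B.det • Wᵀ := by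
    have : Nᵀ * V = -(B.det • Wᵀ) := by
      simpa [Matrix.transpose_mul] using congrArg Matrix.transpose hVN
    rw [hUN, Matrix.mul_neg, Matrix.mul_smul, this, smul_neg, neg_neg]
  have hu : ![U 1 2, U 0 2, U 0 1] = 0 := by
    refine Matrix.eq_zero_of_mulVec_eq_zero hA (funext fun p => ?_)
    have hp := congrFun (congrFun hNUN p) p
    simp only [Matrix.mul_apply, Matrix.transpose_apply, Fin.sum_univ_three, Matrix.smul_apply,
      hW0, hU0, hU.apply 0 1, hU.apply 0 2, hU.apply 1 2, smul_zero] at hp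
    have h2 : (2 : R) * (N 1 p * N 2 p * U 1 2 + N 0 p * N 2 p * U 0 2 + N 0 p * N 1 p * U 0 1)
        = 0 := by
      rw [← hp]; ring
    simpa [Matrix.mulVec, dotProduct, Fin.sum_univ_three] using
      (mul_eq_zero.mp h2).resolve_left two_ne_zero
  have u12 : U 1 2 = 0 := congrFun hu 0
  have u02 : U 0 2 = 0 := congrFun hu 1
  have u01 : U 0 1 = 0 := congrFun hu 2
  have hU' : U = 0 := by
    ext a b
    fin_cases a <;> fin_cases b <;>
      simp [hU0, u12, u02, u01, hU.apply 0 1, hU.apply 0 2, hU.apply 1 2]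
  have hV' : V = 0 := by
    rw [hU', zero_mul, eq_comm, neg_eq_zero] at hUN
    exact (smul_eq_zero.mp hUN).resolve_left hB
  refine ⟨hU', hV', ?_⟩
  rw [hV', Matrix.transpose_zero, zero_mul, eq_comm, neg_eq_zero] at hVN
  exact (smul_eq_zero.mp hVN).resolve_left hB

/-- The coordinate ring of configurations of six vectors in three-space. -/
abbrev ConfigPoly := MvPolynomial (Fin 6 × Fin 3) ℚ

/-- The generic configuration of six vectors in three-space, as the rows of a matrix. -/
def genericConfig : Matrix (Fin 6) (Fin 3) ConfigPoly := Matrix.of fun i a => X (i, a)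

theorem equilibriumStress_genericConfig_eq_zero (G : Matrix (Fin 6) (Fin 6) ConfigPoly)
    (hG : G.IsSymm) (hG0 : ∀ i, G i i = 0) (h : G * genericConfig = 0) : G = 0 := by
  let l : Fin 3 → Fin 6 := Fin.castAdd 3
  let r : Fin 3 → Fin 6 := Fin.natAdd 3
  let q : Fin 6 × Fin 3 → ℚ := fun x =>
    (!![1, 1, 0; 1, 0, 1; 0, 1, 1; 1, 0, 0; 0, 1, 0; 0, 0, 1] : Matrix (Fin 6) (Fin 3) ℚ) x.1 x.2
  have hsum (i : Fin 6) (a : Fin 3) : ∑ j, G i (l j) * genericConfig (l j) a +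
      ∑ j, G i (r j) * genericConfig (r j) a = 0 := by
    exact (Fin.sum_univ_add (a := 3) (b := 3) fun j : Fin 6 => G i j * genericConfig j a).symm.trans
      (congrFun (congrFun h i) a)
  have hqA : (eval q).mapMatrix (genericConfig.submatrix l id) = !![1, 1, 0; 1, 0, 1; 0, 1, 1] := by
    ext a b
    fin_cases a <;> fin_cases b <;> simp [genericConfig, q, l]
  have hqB : (eval q).mapMatrix (genericConfig.submatrix r id) = 1 := by
    ext a b
    fin_cases a <;> fin_cases b <;> simp [genericConfig, q, r]
  have hqN (b a : Fin 3) : eval q ((genericConfig.submatrix l id *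
      (genericConfig.submatrix r id).adjugate) b a) =
      (!![1, 1, 0; 1, 0, 1; 0, 1, 1] : Matrix (Fin 3) (Fin 3) ℚ) b a := by
    rw [← Matrix.map_apply (f := eval q), ← RingHom.mapMatrix_apply, map_mul, RingHom.map_adjugate,
      hqA, hqB, Matrix.adjugate_one, mul_one]
  obtain ⟨hU, hV, hW⟩ := equilibriumStress_eq_zero
    (genericConfig.submatrix l id) (genericConfig.submatrix r id)
    (G.submatrix l l) (G.submatrix l r) (G.submatrix r r) (hG.submatrix l) (fun p => hG0 _)
    (fun p => hG0 _)
    (by ext1 i a; exact hsum (l i) a)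
    (by
      ext1 i a
      have := hsum (r i) a
      simp only [← hG.apply (r i) (l _)] at this
      exact this)
    (fun hz => by
      have := congrArg (eval q) hz
      rw [RingHom.map_det, hqB] at this
      simp at this)
    (fun hz => by
      have := congrArg (eval q) hz
      rw [RingHom.map_det, Matrix.det_fin_three] at this
      simp [hqN] at this)
  ext1 i j
  induction i using Fin.addCases (m := 3) (n := 3) with
  | left i =>
    induction j using Fin.addCases (m := 3) (n := 3) with
    | left j => exact congrFun (congrFun hU i) j
    | right j => exact congrFun (congrFun hV i) j
  | right i =>
    induction j using Fin.addCases (m := 3) (n := 3) with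
    | left j => exact (hG.apply _ _).symm.trans (congrFun (congrFun hV j) i)
    | right j => exact congrFun (congrFun hW i) j

/-- The generic linking numbers specialised to the inner products of the generic configuration. -/
def linkingToConfig : LinkingPoly 6 →ₐ[ℚ] ConfigPoly :=
  aeval fun e => Sym2.lift ⟨(genericConfig * genericConfigᵀ), fun i j => by
    simp [Matrix.mul_apply, mul_comm]⟩ e.val

theorem linkingToConfig_genericLinking (i j : Fin 6) :
    linkingToConfig (genericLinking 6 i j) =
      if i = j then 0 else (genericConfig * genericConfigᵀ) i j := by
  by_cases h : i = j <;> simp [linkingToConfig, genericLinking, h]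

theorem pderiv_gram (i m n : Fin 6) (a : Fin 3) :
    pderiv (i, a) ((genericConfig * genericConfigᵀ) m n) =
      (if m = i then genericConfig n a else 0) + (if n = i then genericConfig m a else 0) := by
  have hX (m : Fin 6) (b : Fin 3) : pderiv (i, a) (X (m, b) : ConfigPoly) =
      if m = i ∧ b = a then 1 else 0 := by
    rw [pderiv_X, Pi.single_apply]
    simp [Prod.ext_iff, eq_comm]
  simp only [Matrix.mul_apply, Matrix.transpose_apply, genericConfig, Matrix.of_apply, map_sum,
    Derivation.leibniz, hX, smul_eq_mul, Finset.sum_add_distrib, ite_and]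
  rw [add_comm]
  congr 1 <;> split_ifs <;> simp

theorem linkingToConfig_injective : Function.Injective linkingToConfig := by
  refine aeval_injective_of_jacobian (fun v : Fin 6 × Fin 3 => pderiv v) _ fun g hg => ?_
  let G : Matrix (Fin 6) (Fin 6) ConfigPoly := Matrix.of fun i j =>
    if h : i = j then 0 else g ⟨s(i, j), by simp [Sym2.mk_isDiag_iff, h]⟩
  have hG : G = 0 := by
    refine equilibriumStress_genericConfig_eq_zero G ?_ (fun i => by simp [G]) ?_
    · ext1 i j
      simp only [G, Matrix.transpose_apply, Matrix.of_apply, Sym2.eq_swap, eq_comm]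
    · ext1 i a
      rw [Matrix.zero_apply, ← hg (i, a), Matrix.mul_apply]
      refine (Fintype.sum_of_injective (fun j : {j // i ≠ j} => j.val) Subtype.val_injective
        (fun j => G i j * genericConfig j a) _ (fun j hj => ?_) fun _ => rfl).symm.trans
        (Fintype.sum_of_injective (fun j : {j // i ≠ j} =>
          (⟨s(i, j), by simpa [Sym2.mk_isDiag_iff] using j.prop⟩ : LinkingVar 6))
          (fun j j' hj => Subtype.ext (Sym2.congr_right.mp (congrArg Subtype.val hj)))
          _ _ (fun e he => ?_) fun j => ?_)
      · have hij : i = j := by simpa using hj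
        simp [G, hij]
      · obtain ⟨e, hd⟩ := e
        induction e with
        | h m n =>
          have hmn : m ≠ n := by simpa using hd
          have hm : m ≠ i := by
            rintro rfl
            exact he ⟨⟨n, hmn⟩, rfl⟩
          have hn : n ≠ i := by
            rintro rfl
            exact he ⟨⟨m, hmn.symm⟩, Subtype.ext Sym2.eq_swap⟩
          rw [Sym2.lift_mk, pderiv_gram, if_neg hm, if_neg hn, add_zero, mul_zero]
      · rw [Sym2.lift_mk, pderiv_gram, if_pos rfl, if_neg j.prop.symm, add_zero]
        simp [G, j.prop]
  funext ⟨e, he⟩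
  induction e with
  | h i j =>
    have hij : i ≠ j := by simpa using he
    simpa [G, hij] using congrFun (congrFun hG i) j

/-- The three coordinate vectors of the generic configuration, followed by three standard basis
vectors. -/
def pluckerRows (i j t : Fin 6) : Matrix (Fin 6) (Fin 6) ConfigPoly :=
  Matrix.of ![genericConfigᵀ 0, genericConfigᵀ 1, genericConfigᵀ 2,
    Pi.single i 1, Pi.single j 1, Pi.single t 1]

theorem det_pluckerRows_swap_left (i j t : Fin 6) :
    (pluckerRows i j t).det = -(pluckerRows j i t).det := by
  have h : pluckerRows i j t =
      (pluckerRows j i t).submatrix (Equiv.swap (3 : Fin 6) 4) id := by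
    ext1 m
    fin_cases m <;> exact fun _ => rfl
  rw [h, Matrix.det_permute, Equiv.Perm.sign_swap (by decide)]
  simp

theorem det_pluckerRows_swap_right (i j t : Fin 6) :
    (pluckerRows i j t).det = -(pluckerRows i t j).det := by
  have h : pluckerRows i j t =
      (pluckerRows i t j).submatrix (Equiv.swap (4 : Fin 6) 5) id := by
    ext1 m
    fin_cases m <;> exact fun _ => rfl
  rw [h, Matrix.det_permute, Equiv.Perm.sign_swap (by decide)]
  simp

theorem det_pluckerRows_self (i t : Fin 6) : (pluckerRows i i t).det = 0 :=
  Matrix.det_zero_of_row_eq (by decide : (3 : Fin 6) ≠ 4) rfl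

theorem sum_gram_mul_det_pluckerRows (i j : Fin 6) :
    ∑ t, (genericConfig * genericConfigᵀ) i t * (pluckerRows i j t).det = 0 := by
  let L : (Fin 6 → ConfigPoly) →ₗ[ConfigPoly] ConfigPoly :=
    { toFun := fun v => ((pluckerRows i j 0).updateRow 5 v).det
      map_add' := Matrix.det_updateRow_add _ 5
      map_smul' := Matrix.det_updateRow_smul _ 5 }
  have hL (v : Fin 6 → ConfigPoly) : L v = ((pluckerRows i j 0).updateRow 5 v).det := rfl
  have hrow (t : Fin 6) : (pluckerRows i j t).det = L (Pi.single t 1) := by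
    rw [hL]
    congr 1
    funext m
    fin_cases m <;> rfl
  have hcol (a : Fin 3) : L (genericConfigᵀ a) = 0 := by
    rw [hL]
    fin_cases a
    · exact Matrix.det_zero_of_row_eq (by decide : (0 : Fin 6) ≠ 5) rfl
    · exact Matrix.det_zero_of_row_eq (by decide : (1 : Fin 6) ≠ 5) rfl
    · exact Matrix.det_zero_of_row_eq (by decide : (2 : Fin 6) ≠ 5) rfl
  have hv : ∑ t, (genericConfig * genericConfigᵀ) i t • (Pi.single t 1 : Fin 6 → ConfigPoly) =
      ∑ a, genericConfig i a • genericConfigᵀ a := by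
    funext t
    simp [Matrix.mul_apply, Pi.single_apply]
  calc _ = L (∑ t, (genericConfig * genericConfigᵀ) i t • Pi.single t 1) := by
        simp [map_sum, hrow]
    _ = 0 := by simp [hv, map_sum, hcol]

theorem det_pluckerRows_ne_zero : (pluckerRows 0 1 2).det ≠ 0 := by
  intro hz
  let q : Fin 6 × Fin 3 → ℚ := fun x =>
    (!![0, 0, 0; 0, 0, 0; 0, 0, 0; 1, 0, 0; 0, 1, 0; 0, 0, 1] : Matrix (Fin 6) (Fin 3) ℚ) x.1 x.2
  have hq : (eval q).mapMatrix (pluckerRows 0 1 2) =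
      (Equiv.addRight (3 : Fin 6)).toPEquiv.toMatrix := by
    ext m n
    rw [RingHom.mapMatrix_apply, Matrix.map_apply]
    fin_cases m <;> fin_cases n <;> simp [pluckerRows, genericConfig, q, PEquiv.toMatrix_apply]
  have := congrArg (eval q) hz
  rw [RingHom.map_det, hq, Matrix.det_permutation] at this
  simp at this

theorem exists_perp_six : ∃ Ω : OrderedTriple 6 → LinkingPoly 6, Ω ≠ 0 ∧
    ∀ i j, ∑ T, conjVec (genericLinking 6) i j T * Ω T = 0 := by
  refine exists_perp_of_base_change linkingToConfig.toRingHom linkingToConfig_injective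
    (fun T => (pluckerRows T.val.1 T.val.2.1 T.val.2.2).det)
    (fun h => det_pluckerRows_ne_zero (congrFun h ⟨(0, 1, 2), by decide⟩)) fun i j => ?_
  rw [sum_conjVec_mul _ (fun a b => ?_) (fun i j t => (pluckerRows i j t).det)
    det_pluckerRows_swap_left det_pluckerRows_swap_right det_pluckerRows_self,
    ← sum_gram_mul_det_pluckerRows i j]
  · refine Finset.sum_congr rfl fun t _ => ?_
    by_cases h : i = t
    · have h0 : (pluckerRows i j t).det = 0 := by
        rw [h, det_pluckerRows_swap_right, det_pluckerRows_self, neg_zero]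
      rw [h0, mul_zero, mul_zero]
    · simp [linkingToConfig_genericLinking, h]
  · simp only [genericLinking, Sym2.eq_swap, eq_comm]

end GenericConfiguration

/-- Theorem 3.3 (key construction): for `k ≥ 6` there is a nonzero vector `Ω` of
polynomials in the generic linking numbers, indexed by the triples `r < s < t`,
which is orthogonal to every partial-conjugation translation vector `V(i,j)`. -/
theorem exists_perp_to_partialConjVecs (k : ℕ) (hk : 6 ≤ k) :
    ∃ Ω : OrderedTriple k → LinkingPoly k, Ω ≠ 0 ∧
      ∀ i j : Fin k, i ≠ j →
        ∑ T : OrderedTriple k, partialConjVecPoly k i j T * Ω T = 0 := by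
  obtain ⟨Ω, hΩ, h⟩ := exists_perp_of_le hk exists_perp_six
  exact ⟨Ω, hΩ, fun i j _ => h i j⟩

end
end
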